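/- Let G be a finite simple graph containing six distinct vertices x, y, x1, x2, y3, y4 such that: x and y are adjacent vertices of degree exactly 3; x1, x2 are the other two neighbors of x and y3, y4 are the other two neighbors of y; each of x1, x2, y3, y4 has degree exactly 2 in G; and the second neighbor of each of x1, x2, y3, y4 lies outside S = {x, y, x1, x2, y3, y4}. If the graph G − S has an FII-partition, then G has an FII-partition. -/

import Mathlib

open scoped Classical

/-- `S` is a *2-independent set* of `G`: any two distinct vertices of `S` are at
distance at least 3 in `G`, i.e. they are non-adjacent and have no common neighbor. -/
def TwoIndepSet {W : Type*} (G : SimpleGraph W) (S : Set W) : Prop :=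
  ∀ u ∈ S, ∀ v ∈ S, u ≠ v → ¬G.Adj u v ∧ ∀ w, ¬(G.Adj u w ∧ G.Adj w v)

/-- `F ⊔ A ⊔ B` is an *FII-partition* of `G`: the three sets partition the vertex set,
the subgraph induced on `F` is a forest (acyclic), and `A`, `B` are 2-independent sets. -/
def IsFIIPartition {W : Type*} (G : SimpleGraph W) (F A B : Set W) : Prop :=
  (∀ v, v ∈ F ∨ v ∈ A ∨ v ∈ B) ∧
    Disjoint F A ∧ Disjoint F B ∧ Disjoint A B ∧
    (G.induce F).IsAcyclic ∧ TwoIndepSet G A ∧ TwoIndepSet G B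

/-- `G` admits some FII-partition. -/
def HasFIIPartition {W : Type*} (G : SimpleGraph W) : Prop :=
  ∃ F A B, IsFIIPartition G F A B

section

open SimpleGraph

variable {V : Type*} {G : SimpleGraph V} {F A B : Set V}

theorem isAcyclic_induce_iff {s : Set V} :
    (G.induce s).IsAcyclic ↔ ∀ u (c : G.Walk u u), c.IsCycle → ∃ v ∈ c.support, v ∉ s := by
  constructor
  · intro h u c hc
    by_contra! hs
    refine h (c.induce s hs) (Walk.IsCycle.of_map (f := (Embedding.induce s).toHom) ?_)
    rwa [Walk.map_induce]
  · intro h u c hc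
    obtain ⟨v, hv, hvs⟩ := h _ _ (hc.map (f := (Embedding.induce s).toHom) Subtype.val_injective)
    rw [Walk.support_map, List.mem_map] at hv
    obtain ⟨w, -, rfl⟩ := hv
    exact hvs w.2

/-- Adding a vertex with at most one neighbor in `F` keeps `F` inducing a forest. -/
theorem isAcyclic_induce_insert {v : V} (hF : (G.induce F).IsAcyclic)
    (hv : ∀ a ∈ F, ∀ b ∈ F, G.Adj v a → G.Adj v b → a = b) :
    (G.induce (insert v F)).IsAcyclic := by
  rw [isAcyclic_induce_iff] at hF ⊢
  intro u c hc
  by_contra! hs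
  by_cases hvc : v ∈ c.support
  · have hc' := hc.rotate hvc
    have hmem {a : V} (ha : a ∈ (c.rotate v hvc).support) (hav : G.Adj v a) : a ∈ F :=
      (hs a ((c.mem_support_rotate_iff v hvc).1 ha)).resolve_left hav.ne'
    have h1 := (c.rotate v hvc).adj_snd hc'.not_nil
    have h2 := ((c.rotate v hvc).adj_penultimate hc'.not_nil).symm
    exact hc'.snd_ne_penultimate (hv _ (hmem (Walk.getVert_mem_support _ _) h1)
      _ (hmem (Walk.getVert_mem_support _ _) h2) h1 h2)
  · obtain ⟨w, hw, hwF⟩ := hF u c hc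
    rcases hs w hw with rfl | h
    exacts [hvc hw, hwF h]

theorem TwoIndepSet.insert {v : V} (hA : TwoIndepSet G A)
    (hv : ∀ a ∈ A, ¬G.Adj v a ∧ ∀ w, G.Adj v w → ¬G.Adj w a) :
    TwoIndepSet G (insert v A) := by
  rintro a (rfl | ha) b (rfl | hb) hab
  · exact absurd rfl hab
  · exact ⟨(hv b hb).1, fun w h => (hv b hb).2 w h.1 h.2⟩
  · exact ⟨fun h => (hv a ha).1 h.symm, fun w h => (hv a ha).2 w h.2.symm h.1.symm⟩
  · exact hA a ha b hb hab

/-- Adjacent 3-vertices `x` and `y` with further neighbors `x1, x2` and `y3, y4` of degree 2,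
whose second neighbors `w1, w2, w3, w4` lie outside `{x, y, x1, x2, y3, y4}`. -/
structure IsAdjacentW3 (G : SimpleGraph V) (x y x1 x2 y3 y4 w1 w2 w3 w4 : V) : Prop where
  ne : List.Pairwise (· ≠ ·) [x, y, x1, x2, y3, y4]
  adj_x : ∀ v, G.Adj x v ↔ v = y ∨ v = x1 ∨ v = x2
  adj_y : ∀ v, G.Adj y v ↔ v = x ∨ v = y3 ∨ v = y4
  adj_x1 : ∀ v, G.Adj x1 v ↔ v = x ∨ v = w1
  adj_x2 : ∀ v, G.Adj x2 v ↔ v = x ∨ v = w2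
  adj_y3 : ∀ v, G.Adj y3 v ↔ v = y ∨ v = w3
  adj_y4 : ∀ v, G.Adj y4 v ↔ v = y ∨ v = w4
  w1_notMem : w1 ∉ ({x, y, x1, x2, y3, y4} : Set V)
  w2_notMem : w2 ∉ ({x, y, x1, x2, y3, y4} : Set V)
  w3_notMem : w3 ∉ ({x, y, x1, x2, y3, y4} : Set V)
  w4_notMem : w4 ∉ ({x, y, x1, x2, y3, y4} : Set V)

/-- A partition of the vertices of `G` outside `S` into sets `F`, `A`, `B` with `F` inducing
a forest and `A`, `B` 2-independent in `G`. -/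
structure IsFIIPartitionOutside (G : SimpleGraph V) (S F A B : Set V) : Prop where
  mem_or : ∀ v ∉ S, v ∈ F ∨ v ∈ A ∨ v ∈ B
  notMem : ∀ v ∈ S, v ∉ F ∧ v ∉ A ∧ v ∉ B
  disjoint_FA : ∀ v ∈ F, v ∉ A
  disjoint_FB : ∀ v ∈ F, v ∉ B
  disjoint_AB : ∀ v ∈ A, v ∉ B
  acyclic : (G.induce F).IsAcyclic
  twoIndep_A : TwoIndepSet G A
  twoIndep_B : TwoIndepSet G B

variable {x y x1 x2 y3 y4 w1 w2 w3 w4 : V}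

theorem IsFIIPartitionOutside.symm {S : Set V} (h : IsFIIPartitionOutside G S F A B) :
    IsFIIPartitionOutside G S F B A where
  mem_or v hv := (h.mem_or v hv).imp_right Or.symm
  notMem v hv := (h.notMem v hv).imp_right And.symm
  disjoint_FA := h.disjoint_FB
  disjoint_FB := h.disjoint_FA
  disjoint_AB v hv hv' := h.disjoint_AB v hv' hv
  acyclic := h.acyclic
  twoIndep_A := h.twoIndep_B
  twoIndep_B := h.twoIndep_A

namespace IsAdjacentW3

theorem swap_leaves (h : IsAdjacentW3 G x y x1 x2 y3 y4 w1 w2 w3 w4) :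
    IsAdjacentW3 G x y x1 x2 y4 y3 w1 w2 w4 w3 := by
  obtain ⟨hne, hx, hy, h1, h2, h3, h4, hw1, hw2, hw3, hw4⟩ := h
  constructor <;> grind

theorem symm (h : IsAdjacentW3 G x y x1 x2 y3 y4 w1 w2 w3 w4) :
    IsAdjacentW3 G y x y3 y4 x1 x2 w3 w4 w1 w2 := by
  obtain ⟨hne, hx, hy, h1, h2, h3, h4, hw1, hw2, hw3, hw4⟩ := h
  constructor <;> grind

/-- Put all six vertices into the forest. -/
theorem hasFIIPartition_of_forall_mem_forest (h : IsAdjacentW3 G x y x1 x2 y3 y4 w1 w2 w3 w4)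
    (hP : IsFIIPartitionOutside G {x, y, x1, x2, y3, y4} F A B)
    (hw1 : w1 ∉ F) (hw2 : w2 ∉ F) (hw4 : w4 ∉ F) : HasFIIPartition G := by
  obtain ⟨hne, hx, hy, h1, h2, h3, h4, hS1, hS2, hS3, hS4⟩ := h
  obtain ⟨hcov, hnot, hFA, hFB, hAB, hac, hA, hB⟩ := hP
  simp only [List.pairwise_cons, List.mem_cons, Set.mem_insert_iff, Set.mem_singleton_iff] at *
  refine ⟨insert x2 (insert x1 (insert x (insert y4 (insert y (insert y3 F))))), A, B,
    ?_, ?_, ?_, ?_, ?_, hA, hB⟩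
  · grind
  · rw [Set.disjoint_left]; grind
  · rw [Set.disjoint_left]; grind
  · rw [Set.disjoint_left]; grind
  · iterate 6 refine isAcyclic_induce_insert ?_ (by grind)
    exact hac

/-- Put `x` into `A` and the other five vertices into the forest. -/
theorem hasFIIPartition_of_mem_indep (h : IsAdjacentW3 G x y x1 x2 y3 y4 w1 w2 w3 w4)
    (hP : IsFIIPartitionOutside G {x, y, x1, x2, y3, y4} F A B)
    (hw1 : w1 ∉ A) (hw2 : w2 ∉ A) (hw4 : w4 ∉ F) : HasFIIPartition G := by
  obtain ⟨hne, hx, hy, h1, h2, h3, h4, hS1, hS2, hS3, hS4⟩ := h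
  obtain ⟨hcov, hnot, hFA, hFB, hAB, hac, hA, hB⟩ := hP
  simp only [List.pairwise_cons, List.mem_cons, Set.mem_insert_iff, Set.mem_singleton_iff] at *
  refine ⟨insert x2 (insert x1 (insert y4 (insert y (insert y3 F)))), insert x A, B,
    ?_, ?_, ?_, ?_, ?_, hA.insert ?_, hB⟩
  · grind
  · rw [Set.disjoint_left]; grind
  · rw [Set.disjoint_left]; grind
  · rw [Set.disjoint_left]; grind
  · iterate 5 refine isAcyclic_induce_insert ?_ (by grind)
    exact hac
  · grind

/-- Put `x` into `A`, `y` into `B` and the other four vertices into the forest. -/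
theorem hasFIIPartition_of_mem_indep_of_mem_indep
    (h : IsAdjacentW3 G x y x1 x2 y3 y4 w1 w2 w3 w4)
    (hP : IsFIIPartitionOutside G {x, y, x1, x2, y3, y4} F A B)
    (hw1 : w1 ∉ A) (hw2 : w2 ∉ A) (hw3 : w3 ∉ B) (hw4 : w4 ∉ B) : HasFIIPartition G := by
  obtain ⟨hne, hx, hy, h1, h2, h3, h4, hS1, hS2, hS3, hS4⟩ := h
  obtain ⟨hcov, hnot, hFA, hFB, hAB, hac, hA, hB⟩ := hP
  simp only [List.pairwise_cons, List.mem_cons, Set.mem_insert_iff, Set.mem_singleton_iff] at *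
  refine ⟨insert x2 (insert x1 (insert y4 (insert y3 F))), insert x A, insert y B,
    ?_, ?_, ?_, ?_, ?_, hA.insert ?_, hB.insert ?_⟩
  · grind
  · rw [Set.disjoint_left]; grind
  · rw [Set.disjoint_left]; grind
  · rw [Set.disjoint_left]; grind
  · iterate 4 refine isAcyclic_induce_insert ?_ (by grind)
    exact hac
  · grind
  · grind

theorem hasFIIPartition_of_notMem (h : IsAdjacentW3 G x y x1 x2 y3 y4 w1 w2 w3 w4)
    (hP : IsFIIPartitionOutside G {x, y, x1, x2, y3, y4} F A B) (hw4 : w4 ∉ F) :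
    HasFIIPartition G := by
  by_cases hwA : w1 ∉ A ∧ w2 ∉ A
  · exact h.hasFIIPartition_of_mem_indep hP hwA.1 hwA.2 hw4
  by_cases hwB : w1 ∉ B ∧ w2 ∉ B
  · exact h.hasFIIPartition_of_mem_indep hP.symm hwB.1 hwB.2 hw4
  obtain ⟨-, -, hFA, hFB, hAB, -, -, -⟩ := id hP
  exact h.hasFIIPartition_of_forall_mem_forest hP (by grind) (by grind) hw4

theorem hasFIIPartition (h : IsAdjacentW3 G x y x1 x2 y3 y4 w1 w2 w3 w4)
    (hP : IsFIIPartitionOutside G {x, y, x1, x2, y3, y4} F A B) : HasFIIPartition G := by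
  by_cases hw4 : w4 ∈ F
  swap
  · exact h.hasFIIPartition_of_notMem hP hw4
  by_cases hw3 : w3 ∈ F
  swap
  · refine h.swap_leaves.hasFIIPartition_of_notMem (F := F) (A := A) (B := B) ?_ hw3
    rwa [Set.pair_comm y4 y3]
  have hS : ({x, y, x1, x2, y3, y4} : Set V) = {y, x, y3, y4, x1, x2} := by grind
  by_cases hw2 : w2 ∈ F
  swap
  · exact h.symm.hasFIIPartition_of_notMem (hS ▸ hP) hw2
  by_cases hw1 : w1 ∈ F
  swap
  · refine h.symm.swap_leaves.hasFIIPartition_of_notMem (F := F) (A := A) (B := B) ?_ hw1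
    rw [Set.pair_comm x2 x1]
    exact hS ▸ hP
  exact h.hasFIIPartition_of_mem_indep_of_mem_indep hP (hP.disjoint_FA _ hw1)
    (hP.disjoint_FA _ hw2) (hP.disjoint_FB _ hw3) (hP.disjoint_FB _ hw4)

end IsAdjacentW3

/-- A 2-independent set of the subgraph induced on `T` is 2-independent in `G` if no two
vertices of `T` have a common neighbor outside `T`. -/
theorem TwoIndepSet.image_val {T : Set V} {A : Set T} (hA : TwoIndepSet (G.induce T) A)
    (hT : ∀ w ∉ T, ∀ u ∈ T, ∀ v ∈ T, G.Adj w u → G.Adj w v → u = v) :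
    TwoIndepSet G (Subtype.val '' A) := by
  rintro _ ⟨a, ha, rfl⟩ _ ⟨b, hb, rfl⟩ hab
  have h := hA a ha b hb (fun e => hab (congrArg _ e))
  refine ⟨h.1, fun w hw => ?_⟩
  by_cases hwT : w ∈ T
  · exact h.2 ⟨w, hwT⟩ hw
  · exact hab (hT w hwT a a.2 b b.2 hw.1.symm hw.2)

theorem isAcyclic_induce_image_val {T : Set V} {F : Set T}
    (hF : ((G.induce T).induce F).IsAcyclic) :
    (G.induce (Subtype.val '' F)).IsAcyclic := by
  have hT (v : ↥(Subtype.val '' F : Set V)) : ∃ h : v.1 ∈ T, ⟨v.1, h⟩ ∈ F := by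
    obtain ⟨_, u, hu, rfl⟩ := v
    exact ⟨u.2, hu⟩
  let f : G.induce (Subtype.val '' F) →g (G.induce T).induce F :=
    { toFun := fun v => ⟨⟨v.1, (hT v).1⟩, (hT v).2⟩
      map_rel' := fun {a b} (h : G.Adj a.1 b.1) => h }
  exact hF.comap f fun a b hab => Subtype.ext (congrArg (fun v => v.1.1) hab)

theorem IsFIIPartition.outside {S : Set V} {F A B : Set (Sᶜ : Set V)}
    (h : IsFIIPartition (G.induce Sᶜ) F A B)
    (hS : ∀ w ∈ S, ∀ u ∉ S, ∀ v ∉ S, G.Adj w u → G.Adj w v → u = v) :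
    IsFIIPartitionOutside G S (Subtype.val '' F) (Subtype.val '' A) (Subtype.val '' B) := by
  obtain ⟨hcov, hFA, hFB, hAB, hac, hA, hB⟩ := h
  have hS' : ∀ w ∉ Sᶜ, ∀ u ∈ Sᶜ, ∀ v ∈ Sᶜ, G.Adj w u → G.Adj w v → u = v :=
    fun w hw => hS w (not_not.1 hw)
  refine ⟨fun v hv => ?_, fun v hv => ?_, ?_, ?_, ?_, isAcyclic_induce_image_val hac,
    hA.image_val hS', hB.image_val hS'⟩
  · simpa [hv] using hcov ⟨v, hv⟩
  · simp [hv]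
  · exact fun v hv => Set.disjoint_left.1 (Set.disjoint_image_of_injective
      Subtype.val_injective hFA) hv
  · exact fun v hv => Set.disjoint_left.1 (Set.disjoint_image_of_injective
      Subtype.val_injective hFB) hv
  · exact fun v hv => Set.disjoint_left.1 (Set.disjoint_image_of_injective
      Subtype.val_injective hAB) hv

theorem exists_adj_iff_of_degree_eq_two {u v : V} [Fintype (G.neighborSet v)]
    (hd : G.degree v = 2) (hu : G.Adj v u) :
    ∃ w, w ≠ u ∧ ∀ z, G.Adj v z ↔ z = u ∨ z = w := by
  rw [← G.card_neighborFinset_eq_degree, Finset.card_eq_two] at hd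
  obtain ⟨a, b, hab, h⟩ := hd
  have h' (z : V) : G.Adj v z ↔ z = a ∨ z = b := by
    rw [← G.mem_neighborFinset, h, Finset.mem_insert, Finset.mem_singleton]
  rcases (h' u).1 hu with rfl | rfl
  · exact ⟨b, hab.symm, h'⟩
  · exact ⟨a, hab, fun z => (h' z).trans or_comm⟩

theorem adj_iff_of_degree_eq_three {v a b c : V} [Fintype (G.neighborSet v)]
    (hd : G.degree v = 3) (ha : G.Adj v a) (hb : G.Adj v b) (hc : G.Adj v c)
    (hab : a ≠ b) (hac : a ≠ c) (hbc : b ≠ c) (z : V) :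
    G.Adj v z ↔ z = a ∨ z = b ∨ z = c := by
  have h : ({a, b, c} : Finset V) = G.neighborFinset v := by
    refine Finset.eq_of_subset_of_card_le ?_ ?_
    · simp [Finset.insert_subset_iff, ha, hb, hc]
    · rw [G.card_neighborFinset_eq_degree, hd, Finset.card_eq_three.2 ⟨a, b, c, hab, hac, hbc, rfl⟩]
  rw [← G.mem_neighborFinset, ← h]
  simp

end

/-- [C5] Two adjacent `W₃`-vertices form a reducible configuration: if `x` and `y` are
adjacent 3-vertices with respective further 2-neighbors `x1, x2` and `y3, y4`, whose
second neighbors lie outside `S = {x, y, x1, x2, y3, y4}`, and `G − S` has an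
FII-partition, then so does `G`. -/
theorem hasFIIPartition_of_adjacent_W3 {V : Type*} [Fintype V]
    (G : SimpleGraph V) (x y x1 x2 y3 y4 : V)
    (hne : List.Pairwise (· ≠ ·) [x, y, x1, x2, y3, y4])
    (hxy : G.Adj x y)
    (hdx : G.degree x = 3) (hdy : G.degree y = 3)
    (hx1 : G.Adj x x1) (hx2 : G.Adj x x2)
    (hy3 : G.Adj y y3) (hy4 : G.Adj y y4)
    (hd1 : G.degree x1 = 2) (hd2 : G.degree x2 = 2)
    (hd3 : G.degree y3 = 2) (hd4 : G.degree y4 = 2)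
    (hout1 : ∀ w, G.Adj x1 w → w ≠ x → w ∉ ({x, y, x1, x2, y3, y4} : Set V))
    (hout2 : ∀ w, G.Adj x2 w → w ≠ x → w ∉ ({x, y, x1, x2, y3, y4} : Set V))
    (hout3 : ∀ w, G.Adj y3 w → w ≠ y → w ∉ ({x, y, x1, x2, y3, y4} : Set V))
    (hout4 : ∀ w, G.Adj y4 w → w ≠ y → w ∉ ({x, y, x1, x2, y3, y4} : Set V))
    (h : HasFIIPartition (G.induce ({x, y, x1, x2, y3, y4} : Set V)ᶜ)) :
    HasFIIPartition G := by
  obtain ⟨w1, hw1, h1⟩ := exists_adj_iff_of_degree_eq_two hd1 hx1.symm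
  obtain ⟨w2, hw2, h2⟩ := exists_adj_iff_of_degree_eq_two hd2 hx2.symm
  obtain ⟨w3, hw3, h3⟩ := exists_adj_iff_of_degree_eq_two hd3 hy3.symm
  obtain ⟨w4, hw4, h4⟩ := exists_adj_iff_of_degree_eq_two hd4 hy4.symm
  have hx := adj_iff_of_degree_eq_three hdx hxy hx1 hx2 (by grind) (by grind) (by grind)
  have hy := adj_iff_of_degree_eq_three hdy hxy.symm hy3 hy4 (by grind) (by grind) (by grind)
  obtain ⟨F, A, B, hP⟩ := h
  have hW : IsAdjacentW3 G x y x1 x2 y3 y4 w1 w2 w3 w4 :=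
    ⟨hne, hx, hy, h1, h2, h3, h4, hout1 w1 ((h1 w1).2 (.inr rfl)) hw1,
      hout2 w2 ((h2 w2).2 (.inr rfl)) hw2, hout3 w3 ((h3 w3).2 (.inr rfl)) hw3,
      hout4 w4 ((h4 w4).2 (.inr rfl)) hw4⟩
  refine hW.hasFIIPartition (hP.outside ?_)
  clear hout1 hout2 hout3 hout4 hP
  simp only [Set.mem_insert_iff, Set.mem_singleton_iff]
  grind
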